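/- Let β > 0 be sufficiently small and let Ω ⊂ ℝ² be a convex body with |Ω △ B₁(0)| ≤ β. Let u(x) := d(x, ∂Ω) and η(x) := 1 − 10β^{3/32} + |x|, and define Γ := {x ∈ Ω : u(x) = η(x)}. Then there exists a universal constant c such that: (i) Γ is the boundary of the convex set {x ∈ Ω : η(x) ≤ u(x)}; (ii) H¹(Γ) ≤ c·β^{3/32}; (iii) Γ ⊂ N_{cβ^{3/16}}(∂B_{5β^{3/32}}(0)); and (iv) for every ϱ ∈ (0, β^{3/16}], |N_{2ϱ}(Γ)| ≤ c·ϱ·β^{3/32}. -/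

import Mathlib

open MeasureTheory Metric
open scoped RealInnerProductSpace ENNReal

noncomputable section

abbrev E2 := EuclideanSpace ℝ (Fin 2)

/-- The contact set `Γ = {x ∈ Ω : d(x, ∂Ω) = 1 − 10β^{3/32} + |x|}`. -/
def contactSet (β : ℝ) (Ω : Set E2) : Set E2 :=
  {x ∈ Ω | Metric.infDist x (frontier Ω) = 1 - 10 * β ^ ((3 : ℝ) / 32) + ‖x‖}

/-- The convex set `{x ∈ Ω : 1 − 10β^{3/32} + |x| ≤ d(x, ∂Ω)}`. -/
def contactBody (β : ℝ) (Ω : Set E2) : Set E2 :=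
  {x ∈ Ω | 1 - 10 * β ^ ((3 : ℝ) / 32) + ‖x‖ ≤ Metric.infDist x (frontier Ω)}

theorem infDist_frontier_eq_infDist_compl {Ω : Set E2} (hΩ : Ω ≠ Set.univ) {x : E2}
    (hx : x ∈ Ω) : infDist x (frontier Ω) = infDist x Ωᶜ := by
  obtain ⟨y, hy, hxy⟩ := exists_mem_frontier_infDist_compl_eq_dist hx hΩ
  apply le_antisymm
  · rw [hxy]
    exact infDist_le_dist_of_mem hy
  · rw [← infDist_closure (s := Ωᶜ)]
    refine infDist_le_infDist_of_subset ?_ ⟨y, hy⟩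
    rw [← frontier_compl]
    exact frontier_subset_closure

theorem concaveOn_infDist_compl {Ω : Set E2} (hconv : Convex ℝ Ω) (hΩ : Ω ≠ Set.univ) :
    ConcaveOn ℝ Ω fun x => infDist x Ωᶜ := by
  refine ⟨hconv, fun x hx y hy a b ha hb hab => ?_⟩
  rw [le_infDist (Set.nonempty_compl.2 hΩ)]
  intro w hw
  by_contra! hlt
  simp only [smul_eq_mul] at hlt
  set R := a * infDist x Ωᶜ + b * infDist y Ωᶜ with hR
  set v := w - (a • x + b • y) with hv
  have hvR : ‖v‖ < R := by rwa [hv, ← dist_eq_norm, dist_comm]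
  have hR0 : 0 < R := (norm_nonneg v).trans_lt hvR
  have key : ∀ z ∈ Ω, z + (infDist z Ωᶜ / R) • v ∈ Ω := by
    intro z hz
    rcases (infDist_nonneg (x := z) (s := Ωᶜ)).eq_or_lt with h0 | h0
    · rw [← h0]
      simpa using hz
    · apply ball_infDist_compl_subset (x := z)
      rw [mem_ball, dist_eq_norm, add_sub_cancel_left, norm_smul, Real.norm_eq_abs,
        abs_of_pos (div_pos h0 hR0), div_mul_eq_mul_div, div_lt_iff₀ hR0]
      gcongr
  apply hw
  have h := hconv (key x hx) (key y hy) ha hb hab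
  convert h using 1
  have h1 : a • (x + (infDist x Ωᶜ / R) • v) + b • (y + (infDist y Ωᶜ / R) • v)
      = (a • x + b • y) + (R / R) • v := by
    rw [hR]
    module
  rw [h1, div_self hR0.ne', one_smul, hv]
  abel

theorem sq_le_of_ball_subset_symmDiff {Ω : Set E2} (hcomp : IsCompact Ω) {β r : ℝ} {p : E2}
    (hr : 0 ≤ r) (hvol : (volume (symmDiff Ω (ball (0 : E2) 1))).toReal ≤ β)
    (hsub : ball p r ⊆ symmDiff Ω (ball (0 : E2) 1)) : r ^ 2 ≤ β := by
  have hfin : volume (symmDiff Ω (ball (0 : E2) 1)) ≠ ∞ := by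
    refine measure_ne_top_of_subset Set.symmDiff_subset_union ?_
    exact (measure_union_lt_top hcomp.measure_lt_top measure_ball_lt_top).ne
  have h := ENNReal.toReal_mono hfin (measure_mono hsub)
  rw [EuclideanSpace.volume_ball_fin_two, ENNReal.toReal_mul, ENNReal.toReal_pow,
    ENNReal.toReal_ofReal hr, ENNReal.toReal_ofReal Real.pi_nonneg] at h
  nlinarith [Real.pi_gt_three, sq_nonneg r]

theorem ball_subset_of_volume_symmDiff_le {Ω : Set E2} (hconv : Convex ℝ Ω) (hcomp : IsCompact Ω)
    (hne : Ω.Nonempty) {β h : ℝ} (hh : 0 < h) (hh1 : h < 1) (hβ : β < h ^ 2 / 4)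
    (hvol : (volume (symmDiff Ω (ball (0 : E2) 1))).toReal ≤ β) : ball (0 : E2) (1 - h) ⊆ Ω := by
  intro p hp
  by_contra hpΩ
  rw [mem_ball_zero_iff] at hp
  obtain ⟨f, s, hfp, hfs⟩ := geometric_hahn_banach_closed_point hconv hcomp.isClosed hpΩ
  obtain ⟨v, rfl⟩ := (InnerProductSpace.toDual ℝ E2).surjective f
  simp only [InnerProductSpace.toDual_apply_apply] at hfp hfs
  have hlt : ∀ b ∈ Ω, inner ℝ v b < inner ℝ v p := fun b hb => (hfp b hb).trans hfs
  have hv : v ≠ 0 := by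
    rintro rfl
    obtain ⟨b, hb⟩ := hne
    simpa using hlt b hb
  have hv0 : 0 < ‖v‖ := norm_pos_iff.2 hv
  set n := ‖v‖⁻¹ • v with hn
  have hn1 : ‖n‖ = 1 := by
    rw [hn, norm_smul, norm_inv, norm_norm, inv_mul_cancel₀ hv0.ne']
  have hlt' : ∀ b ∈ Ω, inner ℝ n b < 1 - h := by
    intro b hb
    have h1 : inner ℝ n b < inner ℝ n p := by
      rw [hn, real_inner_smul_left, real_inner_smul_left]
      exact mul_lt_mul_of_pos_left (hlt b hb) (inv_pos.2 hv0)
    have h2 := real_inner_le_norm n p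
    rw [hn1] at h2
    linarith
  have hsub : ball ((1 - h / 2) • n) (h / 2) ⊆ symmDiff Ω (ball (0 : E2) 1) := by
    intro z hz
    rw [mem_ball, dist_eq_norm] at hz
    set w := z - (1 - h / 2) • n with hw
    have hz' : z = (1 - h / 2) • n + w := by rw [hw]; abel
    refine Or.inr ⟨?_, fun hzΩ => ?_⟩
    · rw [mem_ball_zero_iff, hz']
      refine (norm_add_le _ _).trans_lt ?_
      rw [norm_smul, hn1, Real.norm_eq_abs, abs_of_pos (by linarith)]
      linarith
    · have h1 := hlt' z hzΩ
      have h2 := abs_real_inner_le_norm n w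
      rw [hz', inner_add_right, real_inner_smul_right, real_inner_self_eq_norm_sq, hn1] at h1
      rw [hn1] at h2
      have := neg_abs_le (inner ℝ n w)
      linarith
  have := sq_le_of_ball_subset_symmDiff hcomp (by linarith) hvol hsub
  linarith

theorem subset_closedBall_of_volume_symmDiff_le {Ω : Set E2} (hconv : Convex ℝ Ω)
    (hcomp : IsCompact Ω) {β h : ℝ} (hh : 0 < h) (hh1 : h ≤ 1 / 2) (hβ : β < h ^ 2 / 64)
    (hvol : (volume (symmDiff Ω (ball (0 : E2) 1))).toReal ≤ β)
    (hin : ball (0 : E2) (1 - h) ⊆ Ω) : Ω ⊆ closedBall (0 : E2) (1 + h) := by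
  intro x hx
  by_contra hxb
  rw [mem_closedBall_zero_iff, not_le] at hxb
  have hsub : ball ((1 - h / 4) • x) (h / 8) ⊆ symmDiff Ω (ball (0 : E2) 1) := by
    intro z hz
    rw [mem_ball, dist_eq_norm] at hz
    set w := z - (1 - h / 4) • x with hw
    have hz' : z = (1 - h / 4) • x + w := by rw [hw]; abel
    refine Or.inl ⟨?_, ?_⟩
    · have hmem : (4 / h) • w ∈ Ω := by
        apply hin
        rw [mem_ball_zero_iff, norm_smul, Real.norm_eq_abs, abs_of_pos (by positivity),
          div_mul_eq_mul_div, div_lt_iff₀ hh]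
        nlinarith
      have := hconv hx hmem (a := 1 - h / 4) (b := h / 4) (by linarith) (by linarith) (by ring)
      rwa [smul_smul, div_mul_div_cancel₀ (by norm_num), div_self hh.ne', one_smul, ← hz'] at this
    · rw [mem_ball_zero_iff, not_lt, hz']
      have h1 := norm_sub_le_norm_add ((1 - h / 4) • x) w
      rw [norm_smul, Real.norm_eq_abs, abs_of_pos (by linarith)] at h1
      nlinarith
  have := sq_le_of_ball_subset_symmDiff hcomp (by linarith) hvol hsub
  nlinarith

theorem norm_sub_cos_sin_le (θ φ : ℝ) :
    ‖(!₂[Real.cos θ, Real.sin θ] : E2) - !₂[Real.cos φ, Real.sin φ]‖ ≤ |θ - φ| := by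
  rw [EuclideanSpace.norm_eq]
  apply Real.sqrt_le_iff.2
  refine ⟨abs_nonneg _, ?_⟩
  have h := Real.one_sub_sq_div_two_le_cos (x := θ - φ)
  rw [Real.cos_sub] at h
  simp only [Fin.sum_univ_two, Real.norm_eq_abs, sq_abs]
  simp
  nlinarith [Real.sin_sq_add_cos_sq θ, Real.sin_sq_add_cos_sq φ]

/-- The polar angle of a point of the plane. -/
def polarAngle (x : E2) : ℝ := Complex.arg ⟨x 0, x 1⟩

theorem polarAngle_mem_Icc (x : E2) : polarAngle x ∈ Set.Icc (-Real.pi) Real.pi :=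
  Set.Ioc_subset_Icc_self (Complex.arg_mem_Ioc _)

theorem norm_smul_cos_sin_polarAngle (x : E2) :
    ‖x‖ • (!₂[Real.cos (polarAngle x), Real.sin (polarAngle x)] : E2) = x := by
  have hn : ‖x‖ = ‖(⟨x 0, x 1⟩ : ℂ)‖ := by
    rw [EuclideanSpace.norm_eq, Complex.norm_eq_sqrt_sq_add_sq]
    simp [Fin.sum_univ_two]
  ext i
  fin_cases i
  · simp [hn, polarAngle]
  · simp [hn, polarAngle]

theorem hausdorffMeasure_le_of_dist_le_mul_abs_sub {Γ : Set E2} {ang : E2 → ℝ} {K a b : ℝ}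
    (hK : 0 ≤ K) (hang : ∀ x ∈ Γ, ang x ∈ Set.Icc a b)
    (h : ∀ x ∈ Γ, ∀ y ∈ Γ, dist x y ≤ K * |ang x - ang y|) :
    μH[1] Γ ≤ ENNReal.ofReal (K * (b - a)) := by
  have hinj : Set.InjOn ang Γ := by
    intro x hx y hy hxy
    have := h x hx y hy
    rw [hxy, sub_self, abs_zero, mul_zero] at this
    exact dist_le_zero.1 this
  have hinv : Set.LeftInvOn (Function.invFunOn ang Γ) ang Γ := hinj.leftInvOn_invFunOn
  have hlip : LipschitzOnWith ⟨K, hK⟩ (Function.invFunOn ang Γ) (ang '' Γ) := by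
    apply LipschitzOnWith.of_dist_le_mul
    rintro _ ⟨x, hx, rfl⟩ _ ⟨y, hy, rfl⟩
    rw [hinv hx, hinv hy, Real.dist_eq]
    exact h x hx y hy
  calc μH[1] Γ = μH[1] (Function.invFunOn ang Γ '' (ang '' Γ)) := by
        rw [hinv.image_image]
    _ ≤ ENNReal.ofReal K * μH[1] (ang '' Γ) := by
        have := hlip.hausdorffMeasure_image_le (d := 1) zero_le_one
        rw [ENNReal.rpow_one] at this
        rwa [ENNReal.ofReal_eq_coe_nnreal hK]
    _ ≤ ENNReal.ofReal K * μH[1] (Set.Icc a b) := by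
        gcongr
        rintro _ ⟨x, hx, rfl⟩
        exact hang x hx
    _ = ENNReal.ofReal (K * (b - a)) := by
        rw [hausdorffMeasure_real, Real.volume_Icc, ENNReal.ofReal_mul hK]

theorem volume_thickening_le_of_dist_le_mul_abs_sub {Γ : Set E2} {ang : E2 → ℝ} {K a b r : ℝ}
    {N : ℕ} (hN : 0 < N) (hK : 0 ≤ K) (hab : a < b) (hr : 0 ≤ r)
    (hang : ∀ x ∈ Γ, ang x ∈ Set.Icc a b)
    (h : ∀ x ∈ Γ, ∀ y ∈ Γ, dist x y ≤ K * |ang x - ang y|) :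
    (volume (thickening r Γ)).toReal ≤ (N + 1) * ((K * ((b - a) / N) + r) ^ 2 * Real.pi) := by
  classical
  have hN' : (0 : ℝ) < N := Nat.cast_pos.2 hN
  set l := (b - a) / N with hl
  have hl0 : 0 < l := div_pos (sub_pos.2 hab) hN'
  set R := K * l + r with hR
  have hR0 : 0 ≤ R := by positivity
  let idx : E2 → ℕ := fun x => ⌊(ang x - a) / l⌋₊
  have hidx : ∀ x ∈ Γ, idx x ∈ Finset.range (N + 1) := by
    intro x hx
    rw [Finset.mem_range, Nat.lt_succ_iff]
    apply Nat.floor_le_of_le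
    rw [div_le_iff₀ hl0, hl, mul_div_cancel₀ _ hN'.ne']
    linarith [(hang x hx).2]
  have hclose : ∀ x ∈ Γ, ∀ y ∈ Γ, idx x = idx y → |ang x - ang y| ≤ l := by
    intro x hx y hy hxy
    have h1 : ∀ z ∈ Γ, (idx z : ℝ) * l ≤ ang z - a ∧ ang z - a < (idx z + 1) * l := by
      intro z hz
      have hz0 : 0 ≤ (ang z - a) / l := div_nonneg (by linarith [(hang z hz).1]) hl0.le
      exact ⟨(le_div_iff₀ hl0).1 (Nat.floor_le hz0), (div_lt_iff₀ hl0).1 (Nat.lt_floor_add_one _)⟩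
    have hx1 := h1 x hx
    have hy1 := h1 y hy
    rw [← hxy] at hy1
    rw [abs_le]
    constructor <;> linarith [hx1.1, hx1.2, hy1.1, hy1.2]
  choose! p hp using fun i (hi : ∃ x ∈ Γ, idx x = i) => hi
  have hsub : thickening r Γ ⊆ ⋃ i ∈ Finset.range (N + 1), ball (p i) R := by
    intro z hz
    obtain ⟨x, hx, hzx⟩ := mem_thickening_iff.1 hz
    obtain ⟨hpΓ, hpi⟩ := hp (idx x) ⟨x, hx, rfl⟩
    refine Set.mem_biUnion (hidx x hx) ?_
    have h1 := h x hx _ hpΓ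
    have h2 := mul_le_mul_of_nonneg_left (hclose x hx _ hpΓ hpi.symm) hK
    have h3 := dist_triangle z x (p (idx x))
    rw [mem_ball]
    linarith
  have hle : volume (thickening r Γ) ≤ ENNReal.ofReal ((N + 1) * (R ^ 2 * Real.pi)) := by
    calc volume (thickening r Γ) ≤ ∑ i ∈ Finset.range (N + 1), volume (ball (p i) R) :=
          (measure_mono hsub).trans (measure_biUnion_finset_le _ _)
      _ = ENNReal.ofReal ((N + 1) * (R ^ 2 * Real.pi)) := by
          simp only [EuclideanSpace.volume_ball_fin_two, Finset.sum_const, Finset.card_range,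
            nsmul_eq_mul]
          rw [ENNReal.ofReal_mul (by positivity), ENNReal.ofReal_mul (by positivity),
            ENNReal.ofReal_pow hR0]
          congr 1
          rw [← Nat.cast_succ, ENNReal.ofReal_natCast]
  exact ENNReal.toReal_le_of_le_ofReal (by positivity) hle

theorem zeroSet_eq_frontier_superlevelSet {Ω : Set E2} {f : E2 → ℝ} (hΩ : IsClosed Ω)
    (hf : Continuous f) (hconc : ConcaveOn ℝ Ω f) (h0 : (0 : E2) ∈ Ω) (hf0 : 0 < f 0)
    (hint : {x ∈ Ω | 0 ≤ f x} ⊆ interior Ω) :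
    {x ∈ Ω | f x = 0} = frontier {x ∈ Ω | 0 ≤ f x} := by
  have hcl : IsClosed {x ∈ Ω | 0 ≤ f x} := hΩ.inter (isClosed_le continuous_const hf)
  rw [hcl.frontier_eq]
  ext x
  constructor
  · rintro ⟨hx, hfx⟩
    refine ⟨⟨hx, hfx.ge⟩, fun hxi => ?_⟩
    have htend : Filter.Tendsto (fun t : ℝ => (1 + t) • x) (nhdsWithin 0 (Set.Ioi 0))
        (nhds x) := by
      have : Continuous fun t : ℝ => (1 + t) • x := by fun_prop
      simpa using (this.tendsto 0).mono_left nhdsWithin_le_nhds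
    obtain ⟨t, ht, ht0⟩ :=
      ((htend.eventually (mem_interior_iff_mem_nhds.1 hxi)).and self_mem_nhdsWithin).exists
    obtain ⟨htΩ, htf⟩ : (1 + t) • x ∈ Ω ∧ 0 ≤ f ((1 + t) • x) := ht
    have ht0' : (0 : ℝ) < t := ht0
    have h1 : (0 : ℝ) < 1 + t := by linarith
    have hc := hconc.2 h0 htΩ (show 0 ≤ t / (1 + t) by positivity)
      (show 0 ≤ 1 / (1 + t) by positivity) (by field_simp; ring)
    rw [smul_zero, zero_add, smul_smul, one_div_mul_cancel h1.ne', one_smul, hfx] at hc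
    have : 0 < (t / (1 + t)) • f 0 := smul_pos (by positivity) hf0
    have : 0 ≤ (1 / (1 + t)) • f ((1 + t) • x) := smul_nonneg (by positivity) htf
    linarith
  · rintro ⟨hx, hxi⟩
    refine ⟨hx.1, le_antisymm ?_ hx.2⟩
    by_contra! hlt
    apply hxi
    rw [mem_interior_iff_mem_nhds]
    filter_upwards [mem_interior_iff_mem_nhds.1 (hint hx), (isOpen_lt continuous_const hf).mem_nhds
      hlt] with y hy1 hy2
    exact ⟨hy1, le_of_lt hy2⟩

theorem norm_add_infDist_compl_le {Ω : Set E2} {R : ℝ} {x : E2} (hx0 : x ≠ 0)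
    (hΩ : Ω ⊆ closedBall (0 : E2) R) (hx : x ∈ Ω) : ‖x‖ + infDist x Ωᶜ ≤ R := by
  have hn : 0 < ‖x‖ := norm_pos_iff.2 hx0
  by_contra! hlt
  have hxR : ‖x‖ ≤ R := mem_closedBall_zero_iff.1 (hΩ hx)
  set t := (R - ‖x‖ + infDist x Ωᶜ) / 2 with ht
  have ht0 : 0 ≤ t := by linarith [infDist_nonneg (x := x) (s := Ωᶜ)]
  have hmem : x + (t / ‖x‖) • x ∈ Ω := by
    apply ball_infDist_compl_subset (x := x)
    rw [mem_ball, dist_eq_norm, add_sub_cancel_left, norm_smul, Real.norm_eq_abs,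
      abs_of_nonneg (div_nonneg ht0 hn.le), div_mul_cancel₀ _ hn.ne']
    linarith
  have h := mem_closedBall_zero_iff.1 (hΩ hmem)
  have hxx : x + (t / ‖x‖) • x = (1 + t / ‖x‖) • x := by module
  rw [hxx, norm_smul, Real.norm_eq_abs, abs_of_nonneg (by positivity), add_mul, one_mul,
    div_mul_cancel₀ _ hn.ne'] at h
  linarith

theorem le_infDist_compl_of_ball_subset {Ω : Set E2} {R : ℝ} (hne : Ωᶜ.Nonempty)
    (hΩ : ball (0 : E2) R ⊆ Ω) (x : E2) : R - ‖x‖ ≤ infDist x Ωᶜ := by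
  rw [le_infDist hne]
  intro w hw
  have hwR : R ≤ ‖w‖ := by
    by_contra! hlt
    exact hw (hΩ (mem_ball_zero_iff.2 hlt))
  have := norm_sub_norm_le w x
  rw [dist_comm, dist_eq_norm]
  linarith

/-- A concave function that differs from a 1-Lipschitz function by a radial one has a zero set that
is a Lipschitz graph in polar coordinates. -/
theorem dist_le_two_mul_of_concaveOn {Ω : Set E2} {u f : E2 → ℝ} {m r : ℝ} {x y : E2}
    (hconc : ConcaveOn ℝ Ω f) (hu : LipschitzWith 1 u) (hf : ∀ z, f z = u z - (m + ‖z‖))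
    (h0 : (0 : E2) ∈ Ω) (hr : r ≤ f 0) (hx : f x = 0) (hy : f y = 0)
    (hyΩ : y ∈ Ω) (hx0 : x ≠ 0) (hyr : ‖y‖ ≤ r) (hxy : ‖x‖ ≤ ‖y‖) :
    dist x y ≤ 2 * r * |polarAngle x - polarAngle y| := by
  have hnx : 0 < ‖x‖ := norm_pos_iff.2 hx0
  have hny : 0 < ‖y‖ := hnx.trans_le hxy
  set y' := (‖x‖ / ‖y‖) • y with hy'
  have hny' : ‖y'‖ = ‖x‖ := by
    rw [hy', norm_smul, Real.norm_eq_abs, abs_of_pos (by positivity), div_mul_cancel₀ _ hny.ne']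
  have hle1 : ‖x‖ / ‖y‖ ≤ 1 := (div_le_one hny).2 hxy
  have hc := hconc.2 h0 hyΩ (show 0 ≤ 1 - ‖x‖ / ‖y‖ by linarith)
    (show 0 ≤ ‖x‖ / ‖y‖ by positivity) (by ring)
  rw [smul_zero, zero_add, hy, smul_zero, add_zero, ← hy', smul_eq_mul] at hc
  have hc2 : ‖y‖ - ‖x‖ ≤ f y' := by
    refine le_trans ?_ hc
    calc ‖y‖ - ‖x‖ = (1 - ‖x‖ / ‖y‖) * ‖y‖ := by field_simp
      _ ≤ (1 - ‖x‖ / ‖y‖) * f 0 :=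
        mul_le_mul_of_nonneg_left (hyr.trans hr) (by linarith)
  have hlip : f y' ≤ dist y' x := by
    have h1 := hu.dist_le_mul y' x
    rw [NNReal.coe_one, one_mul, Real.dist_eq] at h1
    have h2 := hf y'
    have h3 := hf x
    rw [hny'] at h2
    linarith [le_abs_self (u y' - u x)]
  have hyy' : dist y' y = ‖y‖ - ‖x‖ := by
    have : y - y' = (1 - ‖x‖ / ‖y‖) • y := by rw [hy']; module
    rw [dist_comm, dist_eq_norm, this, norm_smul, Real.norm_eq_abs, abs_of_nonneg (by linarith)]
    field_simp
  have hang : dist y' x ≤ ‖x‖ * |polarAngle x - polarAngle y| := by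
    have hx2 := norm_smul_cos_sin_polarAngle x
    have hy2 : y' = ‖x‖ • !₂[Real.cos (polarAngle y), Real.sin (polarAngle y)] := by
      rw [hy']
      nth_rewrite 2 [← norm_smul_cos_sin_polarAngle y]
      rw [smul_smul, div_mul_cancel₀ _ hny.ne']
    rw [hy2, dist_comm, dist_eq_norm]
    nth_rewrite 1 [← hx2]
    rw [← smul_sub, norm_smul, norm_norm]
    exact mul_le_mul_of_nonneg_left (norm_sub_cos_sin_le _ _) hnx.le
  have h1 := dist_triangle x y' y
  rw [dist_comm x y'] at h1
  have h2 : ‖x‖ * |polarAngle x - polarAngle y| ≤ r * |polarAngle x - polarAngle y| :=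
    mul_le_mul_of_nonneg_right (hxy.trans hyr) (abs_nonneg _)
  linarith

theorem mem_thickening_sphere {x : E2} {r δ : ℝ} (hx : x ≠ 0) (hr : 0 ≤ r) (h : |‖x‖ - r| < δ) :
    x ∈ thickening δ (sphere (0 : E2) r) := by
  have hn : 0 < ‖x‖ := norm_pos_iff.2 hx
  refine mem_thickening_iff.2 ⟨(r / ‖x‖) • x, ?_, ?_⟩
  · rw [mem_sphere_zero_iff_norm, norm_smul, Real.norm_eq_abs, abs_of_nonneg (by positivity),
      div_mul_cancel₀ _ hn.ne']
  · have : x - (r / ‖x‖) • x = ((‖x‖ - r) / ‖x‖) • x := by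
      rw [sub_div, div_self hn.ne']
      module
    rwa [dist_eq_norm, this, norm_smul, Real.norm_eq_abs, abs_div, abs_norm,
      div_mul_cancel₀ _ hn.ne']

/-- Lemma `LL34` of the paper: the contact set `Γ` is the boundary of a convex
set, has length at most `cβ^{3/32}`, lies in a thin annular neighbourhood of
`∂B_{5β^{3/32}}(0)`, and its `2ϱ`-neighbourhoods have area at most `cϱβ^{3/32}`. -/
theorem statement18 :
    ∃ c : ℝ, 0 < c ∧ ∃ β₀ : ℝ, 0 < β₀ ∧
      ∀ (β : ℝ) (Ω : Set E2), 0 < β → β ≤ β₀ →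
        Convex ℝ Ω → IsCompact Ω → (interior Ω).Nonempty →
        (volume (symmDiff Ω (ball (0 : E2) 1))).toReal ≤ β →
        (Convex ℝ (contactBody β Ω) ∧ contactSet β Ω = frontier (contactBody β Ω)) ∧
        μH[1] (contactSet β Ω) ≤ ENNReal.ofReal (c * β ^ ((3 : ℝ) / 32)) ∧
        contactSet β Ω ⊆ Metric.thickening (c * β ^ ((3 : ℝ) / 16))
          (sphere (0 : E2) (5 * β ^ ((3 : ℝ) / 32))) ∧
        ∀ ϱ : ℝ, 0 < ϱ → ϱ ≤ β ^ ((3 : ℝ) / 16) →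
          (volume (Metric.thickening (2 * ϱ) (contactSet β Ω))).toReal ≤
            c * ϱ * β ^ ((3 : ℝ) / 32) := by
  refine ⟨100000, by norm_num, (1 / 100) ^ ((32 : ℝ) / 3), by positivity, ?_⟩
  intro β Ω hβ hβ0 hconv hcomp hint hvol
  have hε2 : β ^ ((3 : ℝ) / 16) = (β ^ ((3 : ℝ) / 32)) ^ 2 := by
    rw [← Real.rpow_natCast, ← Real.rpow_mul hβ.le]
    norm_num
  have hε0 : 0 < β ^ ((3 : ℝ) / 32) := by positivity
  have hε1 : β ^ ((3 : ℝ) / 32) ≤ 1 / 100 := by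
    calc β ^ ((3 : ℝ) / 32) ≤ ((1 / 100) ^ ((32 : ℝ) / 3)) ^ ((3 : ℝ) / 32) :=
          Real.rpow_le_rpow hβ.le hβ0 (by norm_num)
      _ = 1 / 100 := by
          rw [← Real.rpow_mul (by norm_num)]
          norm_num
  have hβε : β ≤ (β ^ ((3 : ℝ) / 32)) ^ 10 := by
    have hβ1 : β ≤ 1 := hβ0.trans (Real.rpow_le_one (by norm_num) (by norm_num) (by norm_num))
    rw [← Real.rpow_natCast, ← Real.rpow_mul hβ.le]
    conv_lhs => rw [← Real.rpow_one β]
    exact Real.rpow_le_rpow_of_exponent_ge hβ hβ1 (by norm_num)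
  rw [hε2]
  unfold contactSet contactBody
  generalize β ^ ((3 : ℝ) / 32) = ε at hε0 hε1 hβε
  have hεε : ε ^ 2 ≤ ε / 100 := by nlinarith
  have hsq : 0 < ε ^ 2 := by positivity
  have hβ2 : β < (ε ^ 2) ^ 2 / 64 := by
    have h6 : ε ^ 6 < 1 / 64 := by
      calc ε ^ 6 ≤ (1 / 100) ^ 6 := by gcongr
        _ < 1 / 64 := by norm_num
    calc β ≤ ε ^ 4 * ε ^ 6 := by rw [← pow_add]; exact hβε
      _ < ε ^ 4 * (1 / 64) := by gcongr
      _ = (ε ^ 2) ^ 2 / 64 := by ring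
  have hin : ball (0 : E2) (1 - ε ^ 2) ⊆ Ω :=
    ball_subset_of_volume_symmDiff_le hconv hcomp (hint.mono interior_subset) hsq (by linarith)
      (by linarith [sq_nonneg (ε ^ 2)]) hvol
  have hout : Ω ⊆ closedBall (0 : E2) (1 + ε ^ 2) :=
    subset_closedBall_of_volume_symmDiff_le hconv hcomp hsq (by linarith) hβ2 hvol hin
  have huniv : Ω ≠ Set.univ := hcomp.ne_univ
  have hcne : Ωᶜ.Nonempty := Set.nonempty_compl.2 huniv
  have h0 : (0 : E2) ∈ Ω := hin (mem_ball_self (by linarith))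
  obtain ⟨f, hf⟩ : ∃ f : E2 → ℝ, ∀ x, f x = infDist x Ωᶜ - (1 - 10 * ε + ‖x‖) := ⟨_, fun _ => rfl⟩
  have hfc : Continuous f := by
    rw [funext hf]
    exact (continuous_infDist_pt _).sub (by fun_prop)
  have hconc : ConcaveOn ℝ Ω f := by
    rw [funext hf]
    exact (concaveOn_infDist_compl hconv huniv).sub
      ((convexOn_const _ hconv).add (convexOn_norm hconv))
  have hf0 : 9 * ε ≤ f 0 := by
    have h1 := le_infDist_compl_of_ball_subset hcne hin 0
    rw [hf]
    rw [norm_zero] at h1 ⊢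
    linarith
  have hbody : {x ∈ Ω | 1 - 10 * ε + ‖x‖ ≤ infDist x (frontier Ω)} = {x ∈ Ω | 0 ≤ f x} := by
    ext x
    refine and_congr_right fun hx => ?_
    rw [infDist_frontier_eq_infDist_compl huniv hx, hf, sub_nonneg]
  have hset : {x ∈ Ω | infDist x (frontier Ω) = 1 - 10 * ε + ‖x‖} = {x ∈ Ω | f x = 0} := by
    ext x
    refine and_congr_right fun hx => ?_
    rw [infDist_frontier_eq_infDist_compl huniv hx, hf, sub_eq_zero]
  have hupper : ∀ x ∈ Ω, 0 ≤ f x → ‖x‖ ≤ 5 * ε + ε ^ 2 / 2 := by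
    intro x hx hfx
    rcases eq_or_ne x 0 with rfl | hx0
    · rw [norm_zero]
      positivity
    · have := norm_add_infDist_compl_le hx0 hout hx
      rw [hf] at hfx
      linarith
  have hlower : ∀ x, f x = 0 → 5 * ε - ε ^ 2 / 2 ≤ ‖x‖ := by
    intro x hfx
    have := le_infDist_compl_of_ball_subset hcne hin x
    rw [hf] at hfx
    linarith
  have hne0 : ∀ x, f x = 0 → x ≠ 0 := by
    rintro x hfx rfl
    linarith
  rw [hbody, hset]
  have hdist : ∀ x ∈ {x ∈ Ω | f x = 0}, ∀ y ∈ {x ∈ Ω | f x = 0},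
      dist x y ≤ 2 * (6 * ε) * |polarAngle x - polarAngle y| := by
    rintro x ⟨hx, hfx⟩ y ⟨hy, hfy⟩
    rcases le_total ‖x‖ ‖y‖ with hxy | hxy
    · exact dist_le_two_mul_of_concaveOn hconc (lipschitz_infDist_pt _) hf h0 (by linarith) hfx hfy
        hy (hne0 x hfx) (by linarith [hupper y hy hfy.ge]) hxy
    · rw [dist_comm, abs_sub_comm]
      exact dist_le_two_mul_of_concaveOn hconc (lipschitz_infDist_pt _) hf h0 (by linarith) hfy hfx
        hx (hne0 y hfy) (by linarith [hupper x hx hfx.ge]) hxy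
  have hpi := Real.pi_lt_d2
  refine ⟨⟨hconc.convex_ge 0, ?_⟩, ?_, ?_, ?_⟩
  · refine zeroSet_eq_frontier_superlevelSet hcomp.isClosed hfc hconc h0 (by linarith) ?_
    rintro x ⟨hx, hfx⟩
    refine interior_maximal hin isOpen_ball (mem_ball_zero_iff.2 ?_)
    linarith [hupper x hx hfx]
  · refine (hausdorffMeasure_le_of_dist_le_mul_abs_sub (by positivity)
      (fun x _ => polarAngle_mem_Icc x) hdist).trans (ENNReal.ofReal_le_ofReal ?_)
    nlinarith
  · rintro x ⟨hx, hfx⟩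
    refine mem_thickening_sphere (hne0 x hfx) (by positivity) (abs_lt.2 ⟨?_, ?_⟩)
    · linarith [hlower x hfx]
    · linarith [hupper x hx hfx.ge]
  · intro ϱ hϱ hϱε
    have hq : 1 ≤ ε / ϱ := (one_le_div hϱ).2 (by linarith)
    have hN0 : 0 < ⌈ε / ϱ⌉₊ := Nat.ceil_pos.2 (by linarith)
    have hN1 : ε / ϱ ≤ ⌈ε / ϱ⌉₊ := Nat.le_ceil _
    have hN2 : (⌈ε / ϱ⌉₊ : ℝ) < ε / ϱ + 1 := Nat.ceil_lt_add_one (by linarith)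
    refine (volume_thickening_le_of_dist_le_mul_abs_sub hN0 (by positivity)
      (by linarith [Real.pi_pos]) (by positivity) (fun x _ => polarAngle_mem_Icc x) hdist).trans ?_
    have hrad : 2 * (6 * ε) * ((Real.pi - -Real.pi) / ⌈ε / ϱ⌉₊) + 2 * ϱ ≤ 78 * ϱ := by
      have h1 : (Real.pi - -Real.pi) / ⌈ε / ϱ⌉₊ ≤ 6.3 / (ε / ϱ) := by
        gcongr
        linarith
      have h2 : 2 * (6 * ε) * (6.3 / (ε / ϱ)) = 75.6 * ϱ := by
        field_simp
        norm_num
      have h3 := mul_le_mul_of_nonneg_left h1 (by positivity : (0 : ℝ) ≤ 2 * (6 * ε))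
      linarith
    calc _ ≤ (3 * (ε / ϱ)) * ((78 * ϱ) ^ 2 * 4) := by
          have hpos : 0 ≤ 2 * (6 * ε) * ((Real.pi - -Real.pi) / ⌈ε / ϱ⌉₊) + 2 * ϱ := by
            rw [sub_neg_eq_add]
            positivity
          gcongr <;> linarith
      _ = 73008 * (ϱ * ε) := by
          field_simp
          norm_num
      _ ≤ 100000 * ϱ * ε := by nlinarith [mul_pos hϱ hε0]
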